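/- The family of linear maps (T_P), indexed by the set partitions P of Fin k ⊕ Fin ℓ having at most n blocks, is a basis of the subspace of linear maps T : W_k → W_ℓ commuting with the Perm (Fin n)-actions (T(σ • g) = σ • T(g) for all σ and g). -/

import Mathlib

open scoped Classical

noncomputable section

namespace Jellyfish

variable {𝕜 : Type*} [Field 𝕜]

/-- The indicator (delta) function `δ_i` of a tuple `i`, a basis vector of
`W = (ι → Fin n) → 𝕜`. -/
def delta {ι : Type*} {n : ℕ} (i : ι → Fin n) : (ι → Fin n) → 𝕜 :=
  fun j => if j = i then 1 else 0

/-- The linear action of `Equiv.Perm (Fin n)` on `(ι → Fin n) → 𝕜`; it satisfies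
`permAct σ (delta i) = delta (σ ∘ i)`. -/
def permAct {ι : Type*} {n : ℕ} (σ : Equiv.Perm (Fin n)) (g : (ι → Fin n) → 𝕜) :
    (ι → Fin n) → 𝕜 :=
  fun j => g (⇑σ.symm ∘ j)

/-- `DET i`: the determinant of the `n × n` matrix whose `b`-th column is the standard
basis vector `e_{i b}`; entry `(a,b)` is `1` if `i b = a` and `0` otherwise. -/
def DET {n : ℕ} (i : Fin n → Fin n) : 𝕜 :=
  Matrix.det (Matrix.of fun a b => if i b = a then (1 : 𝕜) else 0)

/-- `a` and `b` lie in a common block of the set partition `P`. -/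
def sameBlock {ι : Type*} [DecidableEq ι] [Fintype ι]
    (P : Finpartition (Finset.univ : Finset ι)) (a b : ι) : Prop :=
  ∃ B ∈ P.parts, a ∈ B ∧ b ∈ B

/-- The tuple `i` is constant on every block of the set partition `P`. -/
def constOnBlocks {ι : Type*} [DecidableEq ι] [Fintype ι] {n : ℕ}
    (P : Finpartition (Finset.univ : Finset ι)) (i : ι → Fin n) : Prop :=
  ∀ a b : ι, sameBlock P a b → i a = i b

/-- The kernel (partition into fibers) of the map `p` equals the set partition `P`. -/
def kernelEq {ι : Type*} [DecidableEq ι] [Fintype ι] {m : ℕ}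
    (p : ι → Fin m) (P : Finpartition (Finset.univ : Finset ι)) : Prop :=
  ∀ a b : ι, p a = p b ↔ sameBlock P a b

/-- The linear functional `Φ_P` with `Φ_P (δ_i) = 1` if `i` is constant on every
block of `P`, and `0` otherwise. -/
def PhiP {k n : ℕ} (P : Finpartition (Finset.univ : Finset (Fin k))) :
    ((Fin k → Fin n) → 𝕜) →ₗ[𝕜] 𝕜 :=
  ∑ i : Fin k → Fin n,
    (if constOnBlocks P i then (1 : 𝕜) else 0) •
      (LinearMap.proj i : ((Fin k → Fin n) → 𝕜) →ₗ[𝕜] 𝕜)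

/-- The linear functional `f_P` with `f_P (δ_i) = 1` if the kernel of `i` equals `P`,
and `0` otherwise. -/
def fP {k n : ℕ} (P : Finpartition (Finset.univ : Finset (Fin k))) :
    ((Fin k → Fin n) → 𝕜) →ₗ[𝕜] 𝕜 :=
  ∑ i : Fin k → Fin n,
    (if kernelEq i P then (1 : 𝕜) else 0) •
      (LinearMap.proj i : ((Fin k → Fin n) → 𝕜) →ₗ[𝕜] 𝕜)

/-- The jellyfish functional `J_{p,r}`: `J_{p,r} (δ_i) = DET (i ∘ r)` if `i` is constant
on every fiber of `p`, and `0` otherwise. -/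
def Jf {k n : ℕ} (p : Fin k → Fin n) (r : Fin n → Fin k) :
    ((Fin k → Fin n) → 𝕜) →ₗ[𝕜] 𝕜 :=
  ∑ i : Fin k → Fin n,
    (if ∀ a b : Fin k, p a = p b → i a = i b then DET (i ∘ r) else (0 : 𝕜)) •
      (LinearMap.proj i : ((Fin k → Fin n) → 𝕜) →ₗ[𝕜] 𝕜)

/-- The `n × n` matrix `M(i)` whose column `c`, for `c : Fin (n-1)` embedded as the first
`n-1` columns, is the standard basis vector `e_{i (r c)}`, and whose last column is the
all-ones vector. -/
def Mmat {k n : ℕ} (r : Fin (n - 1) → Fin k) (i : Fin k → Fin n) :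
    Matrix (Fin n) (Fin n) 𝕜 :=
  Matrix.of fun a b =>
    if h : (b : ℕ) < n - 1 then (if i (r ⟨(b : ℕ), h⟩) = a then 1 else 0) else 1

/-- The jellyfish functional `J'_{p,r}` (one dangling leg): `J'_{p,r} (δ_i) = det M(i)`
if `i` is constant on every fiber of `p`, and `0` otherwise. -/
def Jf' {k n : ℕ} (p : Fin k → Fin (n - 1)) (r : Fin (n - 1) → Fin k) :
    ((Fin k → Fin n) → 𝕜) →ₗ[𝕜] 𝕜 :=
  ∑ i : Fin k → Fin n,
    (if ∀ a b : Fin k, p a = p b → i a = i b then (Mmat r i).det else (0 : 𝕜)) •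
      (LinearMap.proj i : ((Fin k → Fin n) → 𝕜) →ₗ[𝕜] 𝕜)

/-- The linear map `T_P : W_k → W_ℓ` with `(T_P δ_i) (i') = 1` if `Sum.elim i i'` is
constant on every block of `P`, and `0` otherwise. -/
def TP {k l n : ℕ} (P : Finpartition (Finset.univ : Finset (Fin k ⊕ Fin l))) :
    ((Fin k → Fin n) → 𝕜) →ₗ[𝕜] ((Fin l → Fin n) → 𝕜) :=
  ∑ i : Fin k → Fin n, ∑ i' : Fin l → Fin n,
    (if constOnBlocks P (Sum.elim i i') then (1 : 𝕜) else 0) •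
      ((LinearMap.single 𝕜 (fun _ : Fin l → Fin n => 𝕜) i').comp
        (LinearMap.proj i : ((Fin k → Fin n) → 𝕜) →ₗ[𝕜] 𝕜))

/-- The subspace of linear functionals on `(ι → Fin n) → 𝕜` invariant under all
permutations in `S`. -/
def invariantDual (𝕜 : Type*) [Field 𝕜] (ι : Type*) {n : ℕ}
    (S : Set (Equiv.Perm (Fin n))) :
    Submodule 𝕜 (((ι → Fin n) → 𝕜) →ₗ[𝕜] 𝕜) where
  carrier := {φ | ∀ σ ∈ S, ∀ g : (ι → Fin n) → 𝕜, φ (permAct σ g) = φ g}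
  add_mem' := by
    intro φ ψ hφ hψ σ hσ g
    simp only [LinearMap.add_apply, hφ σ hσ g, hψ σ hσ g]
  zero_mem' := by intro σ hσ g; simp
  smul_mem' := by
    intro c φ hφ σ hσ g
    simp only [LinearMap.smul_apply, hφ σ hσ g]

/-- The subspace of linear maps `W_k → W_ℓ` commuting with the actions of all
permutations in `S`. -/
def equivariantMaps (𝕜 : Type*) [Field 𝕜] (k l : ℕ) {n : ℕ}
    (S : Set (Equiv.Perm (Fin n))) :
    Submodule 𝕜 (((Fin k → Fin n) → 𝕜) →ₗ[𝕜] ((Fin l → Fin n) → 𝕜)) where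
  carrier := {T | ∀ σ ∈ S, ∀ g : (Fin k → Fin n) → 𝕜, T (permAct σ g) = permAct σ (T g)}
  add_mem' := by
    intro T T' hT hT' σ hσ g
    funext j
    simp [LinearMap.add_apply, hT σ hσ g, hT' σ hσ g, permAct]
  zero_mem' := by intro σ hσ g; funext j; simp [permAct]
  smul_mem' := by
    intro c T hT σ hσ g
    funext j
    simp [LinearMap.smul_apply, hT σ hσ g, permAct]

end Jellyfish

open Jellyfish

namespace Jellyfish

variable {𝕜 : Type*} [Field 𝕜]

/-- Two tuples with the same kernel differ by a permutation of the values. -/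
theorem exists_perm_comp_eq {ι α : Type*} [Finite α] {s t : ι → α}
    (h : ∀ a b, s a = s b ↔ t a = t b) : ∃ σ : Equiv.Perm α, ⇑σ ∘ s = t := by
  have hs (x : {x // x ∈ Set.range s}) : s x.2.choose = x := x.2.choose_spec
  let f : {x // x ∈ Set.range s} → {x // x ∈ Set.range t} :=
    fun x => ⟨t x.2.choose, Set.mem_range_self _⟩
  have hf (a : ι) : (f ⟨s a, Set.mem_range_self a⟩ : α) = t a := (h _ _).1 (hs _)
  have hbij : Function.Bijective f := by
    constructor
    · rintro ⟨_, a, rfl⟩ ⟨_, b, rfl⟩ hab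
      have hab' := congrArg Subtype.val hab
      rw [hf, hf] at hab'
      exact Subtype.ext ((h a b).2 hab')
    · rintro ⟨_, a, rfl⟩
      exact ⟨⟨s a, Set.mem_range_self a⟩, Subtype.ext (hf a)⟩
  refine ⟨(Equiv.ofBijective f hbij).extendSubtype, funext fun a => ?_⟩
  rw [Function.comp_apply, Equiv.extendSubtype_apply_of_mem _ _ (Set.mem_range_self a)]
  exact hf a

section Partition

variable {ι : Type*} [DecidableEq ι] [Fintype ι] {n : ℕ}

theorem sameBlock_iff_mem_part {P : Finpartition (Finset.univ : Finset ι)} {a b : ι} :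
    sameBlock P a b ↔ a ∈ P.part b :=
  P.mem_part_iff_exists.symm

theorem sameBlock_iff_part_eq {P : Finpartition (Finset.univ : Finset ι)} {a b : ι} :
    sameBlock P a b ↔ P.part a = P.part b := by
  rw [sameBlock_iff_mem_part,
    P.mem_part_iff_part_eq_part (Finset.mem_univ _) (Finset.mem_univ _)]

theorem le_of_sameBlock {P Q : Finpartition (Finset.univ : Finset ι)}
    (h : ∀ a b, sameBlock P a b → sameBlock Q a b) : P ≤ Q := by
  intro B hB
  obtain ⟨a, ha⟩ := P.nonempty_of_mem_parts hB
  refine ⟨Q.part a, Q.part_mem.2 (Finset.mem_univ a), fun b hb => ?_⟩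
  exact sameBlock_iff_mem_part.1 (h b a ⟨B, hB, hb, ha⟩)

theorem kernelEq.constOnBlocks {Q : Finpartition (Finset.univ : Finset ι)} {t : ι → Fin n}
    (h : kernelEq t Q) : constOnBlocks Q t :=
  fun a b => (h a b).2

theorem kernelEq.le_of_constOnBlocks {P Q : Finpartition (Finset.univ : Finset ι)}
    {t : ι → Fin n} (h : kernelEq t Q) (hP : Jellyfish.constOnBlocks P t) : P ≤ Q :=
  le_of_sameBlock fun a b hab => (h a b).1 (hP a b hab)

theorem exists_kernelEq {P : Finpartition (Finset.univ : Finset ι)} (hP : P.parts.card ≤ n) :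
    ∃ t : ι → Fin n, kernelEq t P := by
  obtain ⟨e⟩ : Nonempty (P.parts ↪ Fin n) :=
    Function.Embedding.nonempty_of_card_le (by simpa using hP)
  refine ⟨fun a => e ⟨P.part a, P.part_mem.2 (Finset.mem_univ a)⟩, fun a b => ?_⟩
  rw [e.injective.eq_iff, Subtype.mk.injEq, sameBlock_iff_part_eq]

theorem kernelEq.card_parts_le {P : Finpartition (Finset.univ : Finset ι)} {t : ι → Fin n}
    (h : kernelEq t P) : P.parts.card ≤ n := by
  choose r hr using fun B : P.parts => P.nonempty_of_mem_parts B.2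
  have hinj : Function.Injective fun B : P.parts => t (r B) := by
    intro B C hBC
    have hpart := sameBlock_iff_part_eq.1 ((h _ _).1 hBC)
    rw [P.part_eq_of_mem B.2 (hr B), P.part_eq_of_mem C.2 (hr C)] at hpart
    exact Subtype.ext hpart
  simpa using Fintype.card_le_of_injective _ hinj

theorem exists_partition_kernelEq (t : ι → Fin n) :
    ∃ P : Finpartition (Finset.univ : Finset ι), kernelEq t P := by
  refine ⟨Finpartition.ofSetoid (Setoid.ker t), fun a b => ?_⟩
  rw [sameBlock_iff_mem_part, Finpartition.mem_part_ofSetoid_iff_rel, Setoid.ker_def]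
  exact eq_comm

theorem constOnBlocks_perm_comp {P : Finpartition (Finset.univ : Finset ι)}
    (σ : Equiv.Perm (Fin n)) (t : ι → Fin n) :
    constOnBlocks P (⇑σ ∘ t) ↔ constOnBlocks P t := by
  simp [constOnBlocks]

/-- The incidence system of the refinement order on partitions with at most `n` blocks,
evaluated on tuples realizing these partitions, is unitriangular. -/
theorem eq_zero_of_sum_constOnBlocks_eq_zero
    {c : {P : Finpartition (Finset.univ : Finset ι) // P.parts.card ≤ n} → 𝕜}
    {t : {P : Finpartition (Finset.univ : Finset ι) // P.parts.card ≤ n} → ι → Fin n}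
    (ht : ∀ Q, kernelEq (t Q) Q.1)
    (h : ∀ Q, ∑ P, c P * (if constOnBlocks P.1 (t Q) then 1 else 0) = 0) : c = 0 := by
  funext Q
  induction Q using (Finite.to_wellFoundedLT (α :=
      {P : Finpartition (Finset.univ : Finset ι) // P.parts.card ≤ n})).induction with
  | _ Q ih =>
    have hQ := h Q
    rwa [Finset.sum_eq_single Q, if_pos (ht Q).constOnBlocks, mul_one] at hQ
    · intro P _ hPQ
      split_ifs with hP
      · rw [ih P (lt_of_le_of_ne ((ht Q).le_of_constOnBlocks hP) hPQ), Pi.zero_apply, zero_mul]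
      · exact mul_zero _
    · simp

theorem exists_sum_constOnBlocks_eq
    {t : {P : Finpartition (Finset.univ : Finset ι) // P.parts.card ≤ n} → ι → Fin n}
    (ht : ∀ Q, kernelEq (t Q) Q.1)
    (f : {P : Finpartition (Finset.univ : Finset ι) // P.parts.card ≤ n} → 𝕜) :
    ∃ c : {P : Finpartition (Finset.univ : Finset ι) // P.parts.card ≤ n} → 𝕜,
      ∀ Q, ∑ P, c P * (if constOnBlocks P.1 (t Q) then 1 else 0) = f Q := by
  let A := Matrix.vecMulLinear (R := 𝕜) (Matrix.of fun
    P Q : {P : Finpartition (Finset.univ : Finset ι) // P.parts.card ≤ n} =>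
      if constOnBlocks P.1 (t Q) then (1 : 𝕜) else 0)
  have hA : Function.Injective A :=
    (injective_iff_map_eq_zero A).2 fun c hc =>
      eq_zero_of_sum_constOnBlocks_eq_zero ht fun Q => congrFun hc Q
  obtain ⟨c, hc⟩ := LinearMap.injective_iff_surjective.1 hA f
  exact ⟨c, fun Q => congrFun hc Q⟩

end Partition

variable {n k l : ℕ}

theorem TP_apply (P : Finpartition (Finset.univ : Finset (Fin k ⊕ Fin l)))
    (g : (Fin k → Fin n) → 𝕜) (j : Fin l → Fin n) :
    TP P g j = ∑ i, (if constOnBlocks P (Sum.elim i j) then 1 else 0) * g i := by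
  simp only [TP, LinearMap.sum_apply, LinearMap.smul_apply, LinearMap.comp_apply,
    LinearMap.proj_apply, LinearMap.single_apply, Finset.sum_apply, Pi.smul_apply,
    Pi.single_apply, smul_eq_mul]
  simp

theorem TP_delta (P : Finpartition (Finset.univ : Finset (Fin k ⊕ Fin l)))
    (i : Fin k → Fin n) (j : Fin l → Fin n) :
    TP P (delta i : (Fin k → Fin n) → 𝕜) j =
      if constOnBlocks P (Sum.elim i j) then 1 else 0 := by
  simp [TP_apply, delta]

theorem sum_smul_TP_delta {I : Type*} [Fintype I] (c : I → 𝕜)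
    (P : I → Finpartition (Finset.univ : Finset (Fin k ⊕ Fin l)))
    (t : Fin k ⊕ Fin l → Fin n) :
    (∑ p, c p • TP (P p)) (delta (t ∘ Sum.inl)) (t ∘ Sum.inr) =
      ∑ p, c p * (if constOnBlocks (P p) t then 1 else 0) := by
  simp only [LinearMap.sum_apply, Finset.sum_apply, LinearMap.smul_apply, Pi.smul_apply,
    TP_delta, Sum.elim_comp_inl_inr, smul_eq_mul]

theorem permAct_delta {ι : Type*} (σ : Equiv.Perm (Fin n)) (i : ι → Fin n) :
    permAct σ (delta i : (ι → Fin n) → 𝕜) = delta (⇑σ ∘ i) := by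
  funext j
  simp only [permAct, delta, Equiv.symm_comp_eq]

theorem TP_mem_equivariantMaps (P : Finpartition (Finset.univ : Finset (Fin k ⊕ Fin l)))
    (S : Set (Equiv.Perm (Fin n))) : TP P ∈ equivariantMaps 𝕜 k l S := by
  intro σ _ g
  funext j
  rw [permAct, TP_apply, TP_apply]
  refine Fintype.sum_equiv (Equiv.arrowCongr (Equiv.refl _) σ.symm) _ _ fun i => ?_
  have hi : Equiv.arrowCongr (Equiv.refl (Fin k)) σ.symm i = ⇑σ.symm ∘ i := rfl
  rw [hi, ← Sum.comp_elim]
  simp only [constOnBlocks_perm_comp, permAct]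

theorem apply_delta_perm_comp {T : ((Fin k → Fin n) → 𝕜) →ₗ[𝕜] ((Fin l → Fin n) → 𝕜)}
    {S : Set (Equiv.Perm (Fin n))} (hT : T ∈ equivariantMaps 𝕜 k l S)
    {σ : Equiv.Perm (Fin n)} (hσ : σ ∈ S) (i : Fin k → Fin n) (j : Fin l → Fin n) :
    T (delta (⇑σ ∘ i)) (⇑σ ∘ j) = T (delta i) j := by
  rw [← permAct_delta, hT σ hσ, permAct, ← Function.comp_assoc, Equiv.symm_comp_self,
    Function.id_comp]

theorem linearMap_ext_delta {T T' : ((Fin k → Fin n) → 𝕜) →ₗ[𝕜] ((Fin l → Fin n) → 𝕜)}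
    (h : ∀ t : Fin k ⊕ Fin l → Fin n,
      T (delta (t ∘ Sum.inl)) (t ∘ Sum.inr) = T' (delta (t ∘ Sum.inl)) (t ∘ Sum.inr)) :
    T = T' := by
  refine (Pi.basisFun 𝕜 (Fin k → Fin n)).ext fun i => funext fun j => ?_
  have hi : Pi.basisFun 𝕜 (Fin k → Fin n) i = delta i := by
    funext x
    simp [delta, Pi.single_apply]
  rw [hi]
  exact h (Sum.elim i j)

end Jellyfish

/-- the family `(T_P)`, indexed by set partitions of `Fin k ⊕ Fin ℓ` with
at most `n` blocks, is a basis of the subspace of `Perm (Fin n)`-equivariant linear maps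
`W_k → W_ℓ`. -/
theorem statement4 (𝕜 : Type*) [Field 𝕜] (hchar : ringChar 𝕜 ≠ 2)
    (n k l : ℕ) (hn : 0 < n) :
    LinearIndependent 𝕜
      (fun P : {P : Finpartition (Finset.univ : Finset (Fin k ⊕ Fin l)) //
          P.parts.card ≤ n} =>
        (TP P.1 : ((Fin k → Fin n) → 𝕜) →ₗ[𝕜] ((Fin l → Fin n) → 𝕜))) ∧
    Submodule.span 𝕜
        (Set.range fun P : {P : Finpartition (Finset.univ : Finset (Fin k ⊕ Fin l)) //
            P.parts.card ≤ n} =>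
          (TP P.1 : ((Fin k → Fin n) → 𝕜) →ₗ[𝕜] ((Fin l → Fin n) → 𝕜))) =
      equivariantMaps 𝕜 k l (Set.univ : Set (Equiv.Perm (Fin n))) := by
  choose t ht using fun Q : {P : Finpartition (Finset.univ : Finset (Fin k ⊕ Fin l)) //
    P.parts.card ≤ n} => exists_kernelEq Q.2
  refine ⟨Fintype.linearIndependent_iff.2 fun c hc => congrFun <|
    eq_zero_of_sum_constOnBlocks_eq_zero ht fun Q => ?_, le_antisymm ?_ fun T hT => ?_⟩
  · rw [← sum_smul_TP_delta, hc]
    rfl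
  · rw [Submodule.span_le]
    rintro _ ⟨P, rfl⟩
    exact TP_mem_equivariantMaps P.1 _
  · obtain ⟨c, hc⟩ := exists_sum_constOnBlocks_eq ht fun Q =>
      T (delta (t Q ∘ Sum.inl)) (t Q ∘ Sum.inr)
    refine (Submodule.mem_span_range_iff_exists_fun 𝕜).2 ⟨c, linearMap_ext_delta fun s => ?_⟩
    obtain ⟨P, hP⟩ := exists_partition_kernelEq s
    obtain ⟨σ, hσ⟩ := exists_perm_comp_eq fun a b =>
      (ht ⟨P, hP.card_parts_le⟩ a b).trans (hP a b).symm
    rw [← hσ, sum_smul_TP_delta]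
    simp only [constOnBlocks_perm_comp]
    rw [hc]
    exact (apply_delta_perm_comp hT (Set.mem_univ σ) _ _).symm
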